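/- (Proposition 3: symbol equivariance of SE-RRM blocks without task-type embeddings.) For every L : ℕ, the L-layer SE-RRM block commutes with symbol permutations of tensors: SBlockL (SymT ρ Z) = SymT ρ (SBlockL Z) for every ρ : Equiv.Perm (Fin K) and every Z : Fin D → Fin I → Fin K → ℝ. -/

import Mathlib

open Matrix BigOperators

noncomputable def softmax {n : ℕ} (x : Fin n → ℝ) : Fin n → ℝ :=
  fun i => Real.exp (x i) / ∑ j, Real.exp (x j)

noncomputable def Attn {D n : ℕ} (Wq Wk Wv : Matrix (Fin D) (Fin D) ℝ)
    (H : Matrix (Fin D) (Fin n) ℝ) : Matrix (Fin D) (Fin n) ℝ :=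
  fun d j =>
    ∑ i, (softmax (fun i' =>
        dotProduct (Wq.mulVec (fun d => H d j)) (Wk.mulVec (fun d => H d i')))) i *
      (Wv.mulVec (fun d' => H d' i)) d

def PosT {D I K : ℕ} (σ : Equiv.Perm (Fin I)) (Z : Fin D → Fin I → Fin K → ℝ) :
    Fin D → Fin I → Fin K → ℝ :=
  fun d i k => Z d (σ i) k

def SymT {D I K : ℕ} (ρ : Equiv.Perm (Fin K)) (Z : Fin D → Fin I → Fin K → ℝ) :
    Fin D → Fin I → Fin K → ℝ :=
  fun d i k => Z d i (ρ k)

noncomputable def TI {D I K : ℕ} (Wq Wk Wv : Matrix (Fin D) (Fin D) ℝ)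
    (Z : Fin D → Fin I → Fin K → ℝ) : Fin D → Fin I → Fin K → ℝ :=
  fun d i k => (Attn Wq Wk Wv (fun d' i' => Z d' i' k)) d i

noncomputable def TK {D I K : ℕ} (Wq Wk Wv : Matrix (Fin D) (Fin D) ℝ)
    (Z : Fin D → Fin I → Fin K → ℝ) : Fin D → Fin I → Fin K → ℝ :=
  fun d i k => (Attn Wq Wk Wv (fun d' k' => Z d' i k')) d k

def FiberT {D I K : ℕ} (g : (Fin D → ℝ) → (Fin D → ℝ))
    (Z : Fin D → Fin I → Fin K → ℝ) : Fin D → Fin I → Fin K → ℝ :=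
  fun d i k => g (fun d' => Z d' i k) d

noncomputable def SLayer {D I K : ℕ} (Wq Wk Wv Wq' Wk' Wv' : Matrix (Fin D) (Fin D) ℝ)
    (norm m : (Fin D → ℝ) → (Fin D → ℝ))
    (Z : Fin D → Fin I → Fin K → ℝ) : Fin D → Fin I → Fin K → ℝ :=
  let Z' := FiberT norm (Z + TI Wq Wk Wv Z)
  let Z'' := FiberT norm (Z' + TK Wq' Wk' Wv' Z')
  FiberT norm (Z'' + FiberT m Z'')

noncomputable def SBlock {D I K : ℕ} (Wq Wk Wv Wq' Wk' Wv' : Matrix (Fin D) (Fin D) ℝ)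
    (norm m : (Fin D → ℝ) → (Fin D → ℝ)) (L : ℕ) :
    (Fin D → Fin I → Fin K → ℝ) → (Fin D → Fin I → Fin K → ℝ) :=
  (SLayer Wq Wk Wv Wq' Wk' Wv' norm m)^[L]

noncomputable def Emb {D I K : ℕ} (d₀ : Fin D → ℝ) (X : Fin I → Fin K) :
    Fin D → Fin I → Fin K → ℝ :=
  fun a i k => if X i = k then d₀ a else 0

theorem softmax_comp_perm {n : ℕ} (x : Fin n → ℝ) (ρ : Equiv.Perm (Fin n)) (i : Fin n) :
    softmax (fun j => x (ρ j)) i = softmax x (ρ i) := by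
  simp only [softmax, Equiv.sum_comp ρ fun j => Real.exp (x j)]

theorem attn_comp_perm {D n : ℕ} (Wq Wk Wv : Matrix (Fin D) (Fin D) ℝ)
    (H : Matrix (Fin D) (Fin n) ℝ) (ρ : Equiv.Perm (Fin n)) (d : Fin D) (j : Fin n) :
    Attn Wq Wk Wv (fun d' i => H d' (ρ i)) d j = Attn Wq Wk Wv H d (ρ j) := by
  let s : Fin n → ℝ := fun i =>
    dotProduct (Wq.mulVec fun d' => H d' (ρ j)) (Wk.mulVec fun d' => H d' i)
  change ∑ i, softmax (fun i' => s (ρ i')) i * (Wv.mulVec fun d' => H d' (ρ i)) d =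
    ∑ i, softmax s i * (Wv.mulVec fun d' => H d' i) d
  simp only [softmax_comp_perm]
  exact Equiv.sum_comp ρ fun i => softmax s i * (Wv.mulVec fun d' => H d' i) d

theorem TK_symT {D I K : ℕ} (Wq Wk Wv : Matrix (Fin D) (Fin D) ℝ)
    (ρ : Equiv.Perm (Fin K)) (Z : Fin D → Fin I → Fin K → ℝ) :
    TK Wq Wk Wv (SymT ρ Z) = SymT ρ (TK Wq Wk Wv Z) := by
  funext d i k
  exact attn_comp_perm Wq Wk Wv (fun d' k' => Z d' i k') ρ d k

theorem TI_symT {D I K : ℕ} (Wq Wk Wv : Matrix (Fin D) (Fin D) ℝ)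
    (ρ : Equiv.Perm (Fin K)) (Z : Fin D → Fin I → Fin K → ℝ) :
    TI Wq Wk Wv (SymT ρ Z) = SymT ρ (TI Wq Wk Wv Z) := rfl

theorem fiberT_symT {D I K : ℕ} (g : (Fin D → ℝ) → (Fin D → ℝ))
    (ρ : Equiv.Perm (Fin K)) (Z : Fin D → Fin I → Fin K → ℝ) :
    FiberT g (SymT ρ Z) = SymT ρ (FiberT g Z) := rfl

theorem symT_add {D I K : ℕ} (ρ : Equiv.Perm (Fin K)) (Y Z : Fin D → Fin I → Fin K → ℝ) :
    SymT ρ (Y + Z) = SymT ρ Y + SymT ρ Z := rfl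

theorem sLayer_symT {D I K : ℕ} (Wq Wk Wv Wq' Wk' Wv' : Matrix (Fin D) (Fin D) ℝ)
    (norm m : (Fin D → ℝ) → (Fin D → ℝ))
    (ρ : Equiv.Perm (Fin K)) (Z : Fin D → Fin I → Fin K → ℝ) :
    SLayer Wq Wk Wv Wq' Wk' Wv' norm m (SymT ρ Z) =
      SymT ρ (SLayer Wq Wk Wv Wq' Wk' Wv' norm m Z) := by
  simp only [SLayer, TI_symT, TK_symT, fiberT_symT, ← symT_add]

theorem sblock_symbol_equivariant {D I K : ℕ}
    (Wq Wk Wv Wq' Wk' Wv' : Matrix (Fin D) (Fin D) ℝ)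
    (norm m : (Fin D → ℝ) → (Fin D → ℝ)) (L : ℕ)
    (ρ : Equiv.Perm (Fin K)) (Z : Fin D → Fin I → Fin K → ℝ) :
    SBlock Wq Wk Wv Wq' Wk' Wv' norm m L (SymT ρ Z)
      = SymT ρ (SBlock Wq Wk Wv Wq' Wk' Wv' norm m L Z) := by
  have h : Function.Commute (SLayer Wq Wk Wv Wq' Wk' Wv' norm m) (SymT (I := I) ρ) :=
    sLayer_symT Wq Wk Wv Wq' Wk' Wv' norm m ρ
  exact h.iterate_left L Z
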